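/- arXiv:2509.06123 — 2 statements merged into one kernel-verified Lean document; each statement's English description precedes it below -/
import Mathlib

section
/- Let g : ℕ → ℤ be a normalized arithmetic function (g(1) = 1) with g(3) ≡ 0 or 1 (mod 3). Then for all n ≥ 1, P_n^g(i) ≠ 0 and P_n^g(−i) ≠ 0, where i is the imaginary unit in ℂ. -/
open Polynomial

/-- The polynomials `P_n^g ∈ ℚ[X]` defined by `P_0^g = 1` and
`P_n^g = (x/n) ∑_{k=1}^n g(k) P_{n-k}^g` for `n ≥ 1`. -/
noncomputable def darcais (g : ℕ → ℤ) : ℕ → ℚ[X]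
  | 0 => 1
  | n + 1 =>
      C (((n : ℚ) + 1)⁻¹) * X *
        ∑ k ∈ Finset.range (n + 1), C ((g (k + 1) : ℚ)) * darcais g (n - k)
  decreasing_by exact Nat.sub_lt_succ n k

/-- `A_n^g := n! ⬝ P_n^g`. -/
noncomputable def darcaisA (g : ℕ → ℤ) (n : ℕ) : ℚ[X] :=
  (n.factorial : ℚ[X]) * darcais g n

/-- Sum-of-divisors function `σ` as a `ℤ`-valued arithmetic function. -/
def sigma' (n : ℕ) : ℤ := ∑ d ∈ n.divisors, (d : ℤ)

/-- Integer-coefficient model of `darcaisA`, defined by the denominator-free recursion. -/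
noncomputable def darcaisInt (g : ℕ → ℤ) : ℕ → ℤ[X]
  | 0 => 1
  | n + 1 =>
      X * ∑ k ∈ Finset.range (n + 1),
        C (g (k + 1) * (n.descFactorial k : ℤ)) * darcaisInt g (n - k)
  decreasing_by exact Nat.sub_lt_succ n k

theorem darcaisInt_zero (g : ℕ → ℤ) : darcaisInt g 0 = 1 := by
  rw [darcaisInt]

theorem darcaisInt_succ (g : ℕ → ℤ) (n : ℕ) :
    darcaisInt g (n + 1) = X * ∑ k ∈ Finset.range (n + 1),
      C (g (k + 1) * (n.descFactorial k : ℤ)) * darcaisInt g (n - k) := by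
  rw [darcaisInt]

theorem darcaisInt_map (g : ℕ → ℤ) (n : ℕ) :
    (darcaisInt g n).map (Int.castRingHom ℚ) = darcaisA g n := by
  induction n using Nat.strong_induction_on with
  | _ n ih =>
    cases n with
    | zero => simp [darcaisInt_zero, darcaisA, darcais]
    | succ n =>
      have hn : ((n.factorial : ℚ[X]) * C ((n : ℚ) + 1)) * C (((n : ℚ) + 1)⁻¹) =
          n.factorial := by
        rw [mul_assoc, ← C_mul, mul_inv_cancel₀ (by positivity), C_1, mul_one]
      have hA : darcaisA g (n + 1) = X * ∑ k ∈ Finset.range (n + 1),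
          (n.factorial : ℚ[X]) * (C (g (k + 1) : ℚ) * darcais g (n - k)) := by
        rw [darcaisA, darcais, ← Finset.mul_sum, Nat.factorial_succ]
        conv_rhs => rw [← hn]
        simp only [Nat.cast_mul, Nat.cast_add, Nat.cast_one, C_add, C_1, C_eq_natCast]
        ring
      rw [hA, darcaisInt_succ, Polynomial.map_mul, map_X, Polynomial.map_sum]
      congr 1
      refine Finset.sum_congr rfl fun k hk => ?_
      have hk : k ≤ n := Nat.lt_succ_iff.mp (Finset.mem_range.mp hk)
      rw [Polynomial.map_mul, map_C, ih _ (by omega), darcaisA, ← Nat.factorial_mul_descFactorial hk]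
      simp only [eq_intCast, Int.cast_mul, Int.cast_natCast, C_mul, C_eq_natCast,
        Nat.cast_mul]
      ring

/-- In characteristic three the recursion for `darcaisInt` has only three terms. -/
theorem aeval_darcaisInt_succ {R : Type*} [CommRing R] (h3 : (3 : R) = 0) (g : ℕ → ℤ) (x : R)
    (n : ℕ) :
    aeval x (darcaisInt g (n + 1)) = x * (g 1 * aeval x (darcaisInt g n) +
      g 2 * n * aeval x (darcaisInt g (n - 1)) +
      g 3 * (n * (n - 1 : ℕ)) * aeval x (darcaisInt g (n - 2))) := by
  let F : ℕ → R := fun k =>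
    (g (k + 1) : R) * (n.descFactorial k : R) * aeval x (darcaisInt g (n - k))
  have hlow : ∑ k ∈ Finset.range (n + 1), F k = ∑ k ∈ Finset.range (n + 4), F k := by
    refine Finset.sum_subset (Finset.range_mono (by omega)) fun k _ hk => ?_
    have hk : n < k := by simpa using hk
    simp [F, Nat.descFactorial_of_lt hk]
  have hhigh : ∑ k ∈ Finset.range 3, F k = ∑ k ∈ Finset.range (n + 4), F k := by
    refine Finset.sum_subset (Finset.range_mono (by omega)) fun k _ hk => ?_
    have hk : 3 ≤ k := by simpa using hk
    obtain ⟨c, hc⟩ : 3 ∣ n.descFactorial k :=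
      (Nat.dvd_factorial (by norm_num) hk).trans (Nat.factorial_dvd_descFactorial n k)
    simp [F, hc, h3]
  have h : aeval x (darcaisInt g (n + 1)) = x * ∑ k ∈ Finset.range (n + 1), F k := by
    simp [darcaisInt_succ, F, map_sum]
  rw [h, hlow, ← hhigh]
  simp only [Finset.sum_range_succ, Finset.sum_range_zero, F, Nat.descFactorial_succ,
    Nat.descFactorial_zero]
  push_cast
  simp only [Nat.sub_zero]
  ring

theorem aeval_darcaisInt_ne_zero {R : Type*} [CommRing R] [IsDomain R] (h3 : (3 : R) = 0)
    (g : ℕ → ℤ) (hg1 : g 1 = 1) {x : R} (hx : x ≠ 0) (hx2 : x + g 2 ≠ 0)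
    (hx3 : x ^ 2 - g 3 ≠ 0) (n : ℕ) : aeval x (darcaisInt g n) ≠ 0 := by
  have h1 (m : ℕ) : aeval x (darcaisInt g (3 * m + 1)) = x * aeval x (darcaisInt g (3 * m)) := by
    rw [aeval_darcaisInt_succ h3, hg1]
    simp [h3]
  have h2 (m : ℕ) : aeval x (darcaisInt g (3 * m + 2)) =
      x * (x + g 2) * aeval x (darcaisInt g (3 * m)) := by
    rw [aeval_darcaisInt_succ h3, hg1, h1]
    simp [h3]
    ring
  have h0 (m : ℕ) : aeval x (darcaisInt g (3 * (m + 1))) =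
      x * (x ^ 2 - g 3) * aeval x (darcaisInt g (3 * m)) := by
    rw [show 3 * (m + 1) = 3 * m + 2 + 1 by ring, aeval_darcaisInt_succ h3, hg1, h2,
      show 3 * m + 2 - 1 = 3 * m + 1 by omega, h1, Nat.add_sub_cancel]
    push_cast
    linear_combination (x * aeval x (darcaisInt g (3 * m)) *
      (g 2 * x + g 2 * m * x + g 3 * (3 * m ^ 2 + 3 * m + 1))) * h3
  have hmul (m : ℕ) : aeval x (darcaisInt g (3 * m)) ≠ 0 := by
    induction m with
    | zero => simp [darcaisInt_zero]
    | succ m ih => rw [h0]; exact mul_ne_zero (mul_ne_zero hx hx3) ih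
  obtain ⟨m, rfl | rfl | rfl⟩ : ∃ m, n = 3 * m ∨ n = 3 * m + 1 ∨ n = 3 * m + 2 :=
    ⟨n / 3, by omega⟩
  · exact hmul m
  · rw [h1]; exact mul_ne_zero hx (hmul m)
  · rw [h2]; exact mul_ne_zero (mul_ne_zero hx hx2) (hmul m)

theorem aeval_darcais_toComplex_ne_zero (g : ℕ → ℤ) (hg1 : g 1 = 1)
    (hg3 : g 3 % 3 = 0 ∨ g 3 % 3 = 1) {z : GaussianInt} (hre : z.re = 0) (him : z.im ^ 2 = 1)
    (n : ℕ) : aeval (GaussianInt.toComplex z) (darcais g n) ≠ 0 := by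
  intro h
  have hp : Prime (3 : GaussianInt) := by
    have : Fact (Nat.Prime 3) := ⟨Nat.prime_three⟩
    exact_mod_cast GaussianInt.prime_of_nat_prime_of_mod_four_eq_three 3 (by norm_num)
  let I := Ideal.span {(3 : GaussianInt)}
  have : I.IsPrime := (Ideal.span_singleton_prime hp.ne_zero).mpr hp
  let π := Ideal.Quotient.mk I
  have hπ (w : GaussianInt) : π w = 0 ↔ 3 ∣ w.re ∧ 3 ∣ w.im := by
    rw [Ideal.Quotient.eq_zero_iff_mem, Ideal.mem_span_singleton]
    exact_mod_cast Zsqrtd.intCast_dvd 3 w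
  have hunit : ¬ 3 ∣ z.im := by
    rcases sq_eq_one_iff.mp him with h | h <;> rw [h] <;> norm_num
  have h3 : (3 : GaussianInt ⧸ I) = 0 := by
    have := (hπ 3).mpr (by decide)
    rwa [map_ofNat] at this
  have hsq : z ^ 2 = -1 := by
    ext <;> simp [pow_two, hre]
    linarith
  have hx : π z ≠ 0 := fun h => hunit ((hπ z).mp h).2
  have hx2 : π z + g 2 ≠ 0 := by
    rw [← map_intCast π, ← map_add]
    exact fun h => hunit (by simpa using ((hπ _).mp h).2)
  have hx3 : π z ^ 2 - g 3 ≠ 0 := by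
    rw [← map_intCast π, ← map_pow, ← map_sub, hsq]
    intro h
    have := ((hπ _).mp h).1
    simp only [Zsqrtd.re_sub, Zsqrtd.re_neg, Zsqrtd.re_one, Zsqrtd.re_intCast] at this
    omega
  refine aeval_darcaisInt_ne_zero h3 g hg1 hx hx2 hx3 n ?_
  have hC : aeval (GaussianInt.toComplex z) (darcaisInt g n) = 0 := by
    rw [← aeval_map_algebraMap ℚ, algebraMap_int_eq, darcaisInt_map, darcaisA, map_mul, h,
      mul_zero]
  have hz : aeval z (darcaisInt g n) = 0 := by
    rw [← GaussianInt.toComplex_eq_zero, ← hC]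
    exact (aeval_algHom_apply GaussianInt.toComplex.toIntAlgHom z _).symm
  have := aeval_algHom_apply π.toIntAlgHom z (darcaisInt g n)
  rw [hz, map_zero] at this
  exact this

/-- If `g(1) = 1` and `g(3) ≡ 0, 1 (mod 3)`, then for all `n ≥ 1` we have
`P_n^g(i) ≠ 0` and `P_n^g(-i) ≠ 0`. -/
theorem darcais_ne_zero_at_I (g : ℕ → ℤ) (hg1 : g 1 = 1)
    (hg3 : g 3 % 3 = 0 ∨ g 3 % 3 = 1) (n : ℕ) (hn : 1 ≤ n) :
    aeval Complex.I (darcais g n) ≠ 0 ∧ aeval (-Complex.I) (darcais g n) ≠ 0 := by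
  constructor
  · simpa [GaussianInt.toComplex_def'] using
      aeval_darcais_toComplex_ne_zero g hg1 hg3 (z := ⟨0, 1⟩) rfl (by norm_num) n
  · simpa [GaussianInt.toComplex_def'] using
      aeval_darcais_toComplex_ne_zero g hg1 hg3 (z := ⟨0, -1⟩) rfl (by norm_num) n
end

section
/- For every n ≥ 0, the polynomial A_n^σ(x) := n! · P_n^σ(x) is a monic polynomial of degree n with nonnegative integer coefficients. -/
open Polynomial

theorem darcais_succ (g : ℕ → ℤ) (n : ℕ) :
    darcais g (n + 1) = C (((n : ℚ) + 1)⁻¹) * X *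
      ∑ k ∈ Finset.range (n + 1), C ((g (k + 1) : ℚ)) * darcais g (n - k) := by
  rw [darcais]

theorem darcaisA_zero (g : ℕ → ℤ) : darcaisA g 0 = 1 := by
  simp [darcaisA, darcais]

/-- Clearing denominators in the recursion for `P_n^g` leaves falling factorials. -/
theorem darcaisA_succ (g : ℕ → ℤ) (n : ℕ) :
    darcaisA g (n + 1) = X * ∑ k ∈ Finset.range (n + 1),
      C ((n.descFactorial k : ℚ) * (g (k + 1) : ℚ)) * darcaisA g (n - k) := by
  have hC : ((n + 1).factorial : ℚ[X]) * C (((n : ℚ) + 1)⁻¹) = (n.factorial : ℚ[X]) := by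
    rw [← C_eq_natCast, ← C_eq_natCast, ← C_mul, Nat.factorial_succ]
    congr 1
    push_cast
    field_simp
  rw [darcaisA, darcais_succ, ← mul_assoc, ← mul_assoc, hC, mul_comm _ X, mul_assoc,
    Finset.mul_sum]
  congr 1
  refine Finset.sum_congr rfl fun k hk => ?_
  rw [← Nat.factorial_mul_descFactorial (Finset.mem_range_succ_iff.mp hk), darcaisA, C_mul,
    ← C_eq_natCast, ← C_eq_natCast, Nat.cast_mul, C_mul]
  ring

/-- If `g` is nonnegative and `g 1 = 1`, then `A_n^g` comes from a monic polynomial of degree `n`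
over `ℕ`. -/
theorem exists_monic_map_eq_darcaisA {g : ℕ → ℤ} (hg : ∀ n, 0 ≤ g n) (hg1 : g 1 = 1) (n : ℕ) :
    ∃ p : ℕ[X], p.Monic ∧ p.natDegree = n ∧ p.map (Nat.castRingHom ℚ) = darcaisA g n := by
  induction n using Nat.strong_induction_on with
  | _ n ih =>
    cases n with
    | zero => exact ⟨1, monic_one, natDegree_one, by simp [darcaisA_zero]⟩
    | succ n =>
      choose! p hmonic hdeg hmap using ih
      set r : ℕ[X] := ∑ k ∈ Finset.range n,
        C (n.descFactorial (k + 1) * (g (k + 2)).toNat) * p (n - (k + 1)) with hr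
      have hn : n < n + 1 := n.lt_succ_self
      have hlt : r.degree < (p n).degree := by
        rw [degree_eq_natDegree (hmonic n hn).ne_zero, hdeg n hn, hr]
        refine (degree_sum_le _ _).trans_lt ((Finset.sup_lt_iff (WithBot.bot_lt_coe n)).mpr ?_)
        intro k hk
        have hk : k < n := Finset.mem_range.mp hk
        refine degree_le_natDegree.trans_lt (WithBot.coe_lt_coe.mpr ?_)
        refine (natDegree_C_mul_le _ _).trans_lt ?_
        rw [hdeg _ (by omega)]
        omega
      have hq : (p n + r).Monic := (hmonic n hn).add_of_left hlt
      refine ⟨X * (p n + r), monic_X.mul hq, ?_, ?_⟩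
      · rw [natDegree_X_mul hq.ne_zero, natDegree_add_eq_left_of_degree_lt hlt, hdeg n hn]
      · rw [darcaisA_succ, Finset.sum_range_succ', Polynomial.map_mul, map_X, Polynomial.map_add,
          hmap n hn, hr, Polynomial.map_sum, add_comm]
        congr 2
        · refine Finset.sum_congr rfl fun k hk => ?_
          have hk : k < n := Finset.mem_range.mp hk
          have hcast : (((g (k + 2)).toNat : ℕ) : ℚ) = (g (k + 2) : ℚ) := by
            exact_mod_cast congrArg (Int.cast : ℤ → ℚ) (Int.toNat_of_nonneg (hg (k + 2)))
          rw [Polynomial.map_mul, hmap _ (by omega), map_C, eq_natCast, Nat.cast_mul, hcast]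
        · simp [hg1]

/-- For every `n ≥ 0`, the polynomial `A_n^σ := n! ⬝ P_n^σ` is monic of degree `n`
with nonnegative integer coefficients. -/
theorem darcaisA_sigma_monic_natDegree_coeff (n : ℕ) :
    (darcaisA sigma' n).Monic ∧ (darcaisA sigma' n).natDegree = n ∧
      ∀ i : ℕ, ∃ c : ℕ, (darcaisA sigma' n).coeff i = (c : ℚ) := by
  obtain ⟨p, hmonic, hdeg, hmap⟩ := exists_monic_map_eq_darcaisA (g := sigma')
    (fun m => Finset.sum_nonneg fun d _ => Int.natCast_nonneg d) (by simp [sigma']) n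
  rw [← hmap]
  exact ⟨hmonic.map _, by rw [hmonic.natDegree_map, hdeg],
    fun i => ⟨p.coeff i, by rw [coeff_map, eq_natCast]⟩⟩
end
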